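/- Let (𝔫,⟨·,·⟩) be a nilpotent, non-abelian metric Lie algebra of dimension at most 5. Then (𝔫,⟨·,·⟩) is not weakly Einstein. -/

import Mathlib

open Module
open scoped InnerProductSpace BigOperators

noncomputable section

variable {V : Type*} [NormedAddCommGroup V] [InnerProductSpace ℝ V]

/-- `br` is a Lie bracket: bilinear (in the first slot; bilinearity in the second slot
follows from antisymmetry), antisymmetric and satisfying the Jacobi identity. -/
structure IsLieBracket (br : V → V → V) : Prop where
  add_left : ∀ X Y Z : V, br (X + Y) Z = br X Z + br Y Z
  smul_left : ∀ (c : ℝ) (X Y : V), br (c • X) Y = c • br X Y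
  antisymm : ∀ X Y : V, br X Y = - br Y X
  jacobi : ∀ X Y Z : V, br (br X Y) Z + br (br Y Z) X + br (br Z X) Y = 0

/-- `nab` is the Levi-Civita product of the metric Lie algebra `(V, ⟪·,·⟫, br)`,
determined by the Koszul formula. -/
def IsLeviCivita (br nab : V → V → V) : Prop :=
  ∀ U W Z : V, ⟪nab U W, Z⟫_ℝ =
    (1 / 2) * (⟪br U W, Z⟫_ℝ - ⟪br W Z, U⟫_ℝ + ⟪br Z U, W⟫_ℝ)

/-- The curvature operator `R(X,Y)Z = ∇_X ∇_Y Z − ∇_Y ∇_X Z − ∇_{[X,Y]} Z`. -/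
def curvOp (br nab : V → V → V) (X Y Z : V) : V :=
  nab X (nab Y Z) - nab Y (nab X Z) - nab (br X Y) Z

/-- The curvature tensor `R(X,Y,Z,W) = ⟨R(X,Y)Z, W⟩`. -/
def curv (br nab : V → V → V) (X Y Z W : V) : ℝ :=
  ⟪curvOp br nab X Y Z, W⟫_ℝ

/-- `Ř(X,Y) = Σ_{a,b,c} R(X,e_a,e_b,e_c) R(Y,e_a,e_b,e_c)` relative to an
orthonormal basis `e`. -/
def checkR (br nab : V → V → V) {ι : Type*} [Fintype ι]
    (e : OrthonormalBasis ι ℝ V) (X Y : V) : ℝ :=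
  ∑ a, ∑ b, ∑ c,
    curv br nab X (e a) (e b) (e c) * curv br nab Y (e a) (e b) (e c)

/-- The metric Lie algebra is weakly Einstein:
`Ř(X,Y) = (‖R‖²/n) ⟨X,Y⟩` where `‖R‖² = Σ_i Ř(e_i,e_i)` and `n = dim V`. -/
def WeaklyEinstein (br nab : V → V → V) {ι : Type*} [Fintype ι]
    (e : OrthonormalBasis ι ℝ V) : Prop :=
  ∀ X Y : V, checkR br nab e X Y =
    ((∑ i, checkR br nab e (e i) (e i)) / (Fintype.card ι : ℝ)) * ⟪X, Y⟫_ℝ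

/-- The Ricci form `Ric(X,Y) = Σ_a R(e_a,X,Y,e_a)`. -/
def ricci (br nab : V → V → V) {ι : Type*} [Fintype ι]
    (e : OrthonormalBasis ι ℝ V) (X Y : V) : ℝ :=
  ∑ a, curv br nab (e a) X Y (e a)

/-- The metric Lie algebra is Einstein: the Ricci form is a scalar multiple
of the inner product. -/
def IsEinstein (br nab : V → V → V) {ι : Type*} [Fintype ι]
    (e : OrthonormalBasis ι ℝ V) : Prop :=
  ∃ κ : ℝ, ∀ X Y : V, ricci br nab e X Y = κ * ⟪X, Y⟫_ℝ

/-- A (Lie) bracket is nilpotent: all sufficiently long iterated brackets vanish. -/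
def IsNilpotentBracket (br : V → V → V) : Prop :=
  ∃ k : ℕ, ∀ (f : Fin k → V) (X : V), (List.ofFn f).foldr br X = 0

/-! ### Curvature in terms of structure constants -/

/-- The Christoffel symbols attached to the structure constants `c i j k = ⟪[eᵢ, eⱼ], eₖ⟫`. -/
def christoffel (c : Fin 5 → Fin 5 → Fin 5 → ℝ) (i j k : Fin 5) : ℝ :=
  (1 / 2) * (c i j k - c j k i + c k i j)

/-- The curvature components attached to the structure constants `c`. -/
def curvCoeff (c : Fin 5 → Fin 5 → Fin 5 → ℝ) (x y z w : Fin 5) : ℝ :=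
  ∑ m, (christoffel c y z m * christoffel c x m w - christoffel c x z m * christoffel c y m w
    - c x y m * christoffel c m z w)

/-- The squared norm of the curvature operator `R(eₓ, e_y)`. -/
def curvNormSq (c : Fin 5 → Fin 5 → Fin 5 → ℝ) (x y : Fin 5) : ℝ :=
  ∑ z, ∑ w, curvCoeff c x y z w ^ 2

/-- The structure constants of an adapted frame of a nilpotent metric Lie algebra. -/
def adaptedConst (a b c d f g h : ℝ) : Fin 5 → Fin 5 → Fin 5 → ℝ :=
  ![![![0, 0, 0, 0, 0], ![0, 0, a, b, c], ![0, 0, 0, d, f], ![0, 0, 0, 0, g], ![0, 0, 0, 0, 0]],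
    ![![0, 0, -a, -b, -c], ![0, 0, 0, 0, 0], ![0, 0, 0, 0, h], ![0, 0, 0, 0, 0], ![0, 0, 0, 0, 0]],
    ![![0, 0, 0, -d, -f], ![0, 0, 0, 0, -h], ![0, 0, 0, 0, 0], ![0, 0, 0, 0, 0], ![0, 0, 0, 0, 0]],
    ![![0, 0, 0, 0, -g], ![0, 0, 0, 0, 0], ![0, 0, 0, 0, 0], ![0, 0, 0, 0, 0], ![0, 0, 0, 0, 0]],
    ![![0, 0, 0, 0, 0], ![0, 0, 0, 0, 0], ![0, 0, 0, 0, 0], ![0, 0, 0, 0, 0], ![0, 0, 0, 0, 0]]]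

theorem quartic_pos (a b c d f g h : ℝ) :
   (1 / 10) * (a^4 + b^4 + c^4 + d^4 + f^4 + g^4 + h^4) ≤ 11*a^4 + 22*a^2*b^2 + 17*a^2*c^2
    - 2*a^2*d^2 - 7*a^2*f^2 - a^2*g^2 - 7*a^2*h^2 - 12*a*b*f*g + 14*a*c*d*g + 11*b^4
    + 17*b^2*c^2 + 22*b^2*d^2 - b^2*f^2 - 7*b^2*g^2 - b^2*h^2 + 36*b*c*d*f + 6*c^4 - c^2*d^2
    + 12*c^2*f^2 + 12*c^2*g^2 + 12*c^2*h^2 + 11*d^4 + 17*d^2*f^2 - 7*d^2*g^2 - d^2*h^2 + 6*f^4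
    + 12*f^2*g^2 + 12*f^2*h^2 + 6*g^4 + 12*g^2*h^2 + 6*h^4 := by
  have h₁ : -(12 * (b * c) ^ 2 + 12 * (d * f) ^ 2) ≤ 24 * b * c * d * f := by
    linarith [sq_nonneg (b * c + d * f)]
  have h₂ : -(6 * (b * d) ^ 2 + 6 * (c * f) ^ 2) ≤ 12 * b * c * d * f := by
    linarith [sq_nonneg (b * d + c * f)]
  have h₃ : -(12 * (a * b) ^ 2 + 3 * (f * g) ^ 2) ≤ -(12 * a * b * f * g) := by
    linarith [sq_nonneg (2 * (a * b) - f * g)]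
  have h₄ : -(5 * (a * d) ^ 2 + 10 * (c * g) ^ 2) ≤ 14 * a * c * d * g := by
    linarith [sq_nonneg (7 * (c * g) + 5 * (a * d)), sq_nonneg (c * g)]
  have h₅ (A B C D F G H : ℝ) (hA : 0 ≤ A) (hB : 0 ≤ B) (hC : 0 ≤ C) (hD : 0 ≤ D) (hF : 0 ≤ F)
      (hG : 0 ≤ G) (hH : 0 ≤ H) :
      (1 / 10) * (A^2 + B^2 + C^2 + D^2 + F^2 + G^2 + H^2) ≤ 11*A^2 + 10*A*B + 17*A*C - 7*A*D
        - 7*A*F - A*G - 7*A*H + 11*B^2 + 5*B*C + 16*B*D - B*F - 7*B*G - B*H + 6*C^2 - C*D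
        + 6*C*F + 2*C*G + 12*C*H + 11*D^2 + 5*D*F - 7*D*G - D*H + 6*F^2 + 9*F*G + 12*F*H
        + 6*G^2 + 12*G*H + 6*H^2 := by
    linarith [sq_nonneg (70 * (A + B + D) - 103 * (F + G + H)), sq_nonneg (A - D),
      sq_nonneg (F - G), sq_nonneg (C - D), mul_nonneg hA hB, mul_nonneg hA hC, mul_nonneg hA hG,
      mul_nonneg hB hC, mul_nonneg hB hD, mul_nonneg hB hF, mul_nonneg hB hH, mul_nonneg hC hF,
      mul_nonneg hC hG, mul_nonneg hC hH, mul_nonneg hD hF, mul_nonneg hD hH, mul_nonneg hF hG,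
      mul_nonneg hF hH, mul_nonneg hG hH, sq_nonneg A, sq_nonneg B, sq_nonneg D, sq_nonneg C,
      sq_nonneg F, sq_nonneg G, sq_nonneg H]
  have := h₅ (a^2) (b^2) (c^2) (d^2) (f^2) (g^2) (h^2) (by positivity) (by positivity)
    (by positivity) (by positivity) (by positivity) (by positivity) (by positivity)
  linarith

/-- The Christoffel symbols of an adapted frame. -/
def adaptedChristoffel (a b c d f g h : ℝ) : Fin 5 → Fin 5 → Fin 5 → ℝ :=
  ![![![0, 0, 0, 0, 0], ![0, 0, a / 2, b / 2, c / 2], ![0, -a / 2, 0, d / 2, f / 2],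
      ![0, -b / 2, -d / 2, 0, g / 2], ![0, -c / 2, -f / 2, -g / 2, 0]],
    ![![0, 0, -a / 2, -b / 2, -c / 2], ![0, 0, 0, 0, 0], ![a / 2, 0, 0, 0, h / 2],
      ![b / 2, 0, 0, 0, 0], ![c / 2, 0, -h / 2, 0, 0]],
    ![![0, -a / 2, 0, -d / 2, -f / 2], ![a / 2, 0, 0, 0, -h / 2], ![0, 0, 0, 0, 0],
      ![d / 2, 0, 0, 0, 0], ![f / 2, h / 2, 0, 0, 0]],
    ![![0, -b / 2, -d / 2, 0, -g / 2], ![b / 2, 0, 0, 0, 0], ![d / 2, 0, 0, 0, 0],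
      ![0, 0, 0, 0, 0], ![g / 2, 0, 0, 0, 0]],
    ![![0, -c / 2, -f / 2, -g / 2, 0], ![c / 2, 0, -h / 2, 0, 0], ![f / 2, h / 2, 0, 0, 0],
      ![g / 2, 0, 0, 0, 0], ![0, 0, 0, 0, 0]]]

theorem christoffel_adaptedConst (a b c d f g h : ℝ) :
    christoffel (adaptedConst a b c d f g h) = adaptedChristoffel a b c d f g h := by
  funext i j k
  fin_cases i <;> fin_cases j <;> fin_cases k <;>
    simp [christoffel, adaptedConst, adaptedChristoffel, div_eq_inv_mul]

theorem curvCoeff_swap (c : Fin 5 → Fin 5 → Fin 5 → ℝ) (hc : ∀ i j k, c i j k = -c j i k)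
    (x y z w : Fin 5) : curvCoeff c x y z w = -curvCoeff c y x z w := by
  rw [curvCoeff, curvCoeff, ← Finset.sum_neg_distrib]
  refine Finset.sum_congr rfl fun m _ => ?_
  rw [hc x y m]
  ring

theorem curvNormSq_comm (c : Fin 5 → Fin 5 → Fin 5 → ℝ) (hc : ∀ i j k, c i j k = -c j i k)
    (x y : Fin 5) : curvNormSq c x y = curvNormSq c y x := by
  simp only [curvNormSq, curvCoeff_swap c hc x y, neg_sq]

theorem curvNormSq_self (c : Fin 5 → Fin 5 → Fin 5 → ℝ) (hc : ∀ i j k, c i j k = -c j i k)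
    (x : Fin 5) : curvNormSq c x x = 0 := by
  have h z w : curvCoeff c x x z w = 0 := by linarith [curvCoeff_swap c hc x x z w]
  simp [curvNormSq, h]

theorem sum_curvNormSq_sub (c : Fin 5 → Fin 5 → Fin 5 → ℝ) (hc : ∀ i j k, c i j k = -c j i k) :
    ∑ x, ∑ y, curvNormSq c x y - 5 * ∑ y, curvNormSq c 4 y =
      2 * (curvNormSq c 0 1 + curvNormSq c 0 2 + curvNormSq c 0 3 + curvNormSq c 1 2
        + curvNormSq c 1 3 + curvNormSq c 2 3) - 3 * (curvNormSq c 0 4 + curvNormSq c 1 4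
        + curvNormSq c 2 4 + curvNormSq c 3 4) := by
  simp only [Fin.sum_univ_five, curvNormSq_self c hc]
  rw [curvNormSq_comm c hc 1 0, curvNormSq_comm c hc 2 0, curvNormSq_comm c hc 3 0,
    curvNormSq_comm c hc 4 0, curvNormSq_comm c hc 2 1, curvNormSq_comm c hc 3 1,
    curvNormSq_comm c hc 4 1, curvNormSq_comm c hc 3 2, curvNormSq_comm c hc 4 2,
    curvNormSq_comm c hc 4 3]
  ring

set_option maxHeartbeats 4000000 in
set_option maxRecDepth 100000 in
theorem sum_curvNormSq_adaptedConst (a b c d f g h : ℝ)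
    (hc : ∀ i j k, adaptedConst a b c d f g h i j k = -adaptedConst a b c d f g h j i k) :
    ∑ x, ∑ y, curvNormSq (adaptedConst a b c d f g h) x y
        - 5 * ∑ y, curvNormSq (adaptedConst a b c d f g h) 4 y =
      (1 / 4) * (11*a^4 + 22*a^2*b^2 + 17*a^2*c^2
        - 2*a^2*d^2 - 7*a^2*f^2 - a^2*g^2 - 7*a^2*h^2 - 12*a*b*f*g + 14*a*c*d*g + 11*b^4
        + 17*b^2*c^2 + 22*b^2*d^2 - b^2*f^2 - 7*b^2*g^2 - b^2*h^2 + 36*b*c*d*f + 6*c^4 - c^2*d^2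
        + 12*c^2*f^2 + 12*c^2*g^2 + 12*c^2*h^2 + 11*d^4 + 17*d^2*f^2 - 7*d^2*g^2 - d^2*h^2 + 6*f^4
        + 12*f^2*g^2 + 12*f^2*h^2 + 6*g^4 + 12*g^2*h^2 + 6*h^4) := by
  rw [sum_curvNormSq_sub _ hc]
  simp only [curvNormSq, curvCoeff, christoffel_adaptedConst, Fin.sum_univ_five]
  simp [adaptedConst, adaptedChristoffel]
  ring

theorem adaptedConst_zero (i j k : Fin 5) : adaptedConst 0 0 0 0 0 0 0 i j k = 0 := by
  fin_cases i <;> fin_cases j <;> fin_cases k <;> simp [adaptedConst]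

theorem eq_adaptedConst {c : Fin 5 → Fin 5 → Fin 5 → ℝ} (hc : ∀ i j k, c i j k = -c j i k)
    (h0 : ∀ i j, c i j 0 = 0) (h1 : ∀ i j, c i j 1 = 0) (h22 : ∀ i, c i 2 2 = 0)
    (h32 : ∀ i, c i 3 2 = 0) (h33 : ∀ i, c i 3 3 = 0) (h4 : ∀ i k, c i 4 k = 0)
    (h234 : c 2 3 4 = 0) (h123 : c 1 2 3 = 0) (h134 : c 1 3 4 = 0) :
    c = adaptedConst (c 0 1 2) (c 0 1 3) (c 0 1 4) (c 0 2 3) (c 0 2 4) (c 0 3 4) (c 1 2 4) := by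
  have hself (i k : Fin 5) : c i i k = 0 := by linarith [hc i i k]
  have h22' (i : Fin 5) : c 2 i 2 = 0 := by rw [hc, h22, neg_zero]
  have h32' (i : Fin 5) : c 3 i 2 = 0 := by rw [hc, h32, neg_zero]
  have h33' (i : Fin 5) : c 3 i 3 = 0 := by rw [hc, h33, neg_zero]
  have h4' (i k : Fin 5) : c 4 i k = 0 := by rw [hc, h4, neg_zero]
  funext i j k
  fin_cases i <;> fin_cases j <;> fin_cases k <;>
    simp [adaptedConst, hself, h0, h1, h22, h32, h33, h4, h22', h32', h33', h4', h234, h123, h134,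
      hc 1 0, hc 2 0, hc 3 0, hc 2 1, hc 3 1, hc 3 2]

/-! ### Brackets and ideals -/

namespace IsLieBracket

variable {br : V → V → V}

theorem add_right (hbr : IsLieBracket br) (X Y Z : V) : br X (Y + Z) = br X Y + br X Z := by
  rw [hbr.antisymm, hbr.add_left, hbr.antisymm Y, hbr.antisymm Z]
  abel

theorem smul_right (hbr : IsLieBracket br) (t : ℝ) (X Y : V) : br X (t • Y) = t • br X Y := by
  rw [hbr.antisymm, hbr.smul_left, hbr.antisymm Y, smul_neg, neg_neg]

theorem self (hbr : IsLieBracket br) (X : V) : br X X = 0 := by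
  have h := eq_neg_iff_add_eq_zero.mp (hbr.antisymm X X)
  simpa [← two_smul ℝ] using h

theorem zero_right (hbr : IsLieBracket br) (X : V) : br X 0 = 0 := by
  simpa using hbr.smul_right 0 X 0

theorem sub_right (hbr : IsLieBracket br) (X Y Z : V) : br X (Y - Z) = br X Y - br X Z := by
  rw [eq_sub_iff_add_eq, ← hbr.add_right, sub_add_cancel]

/-- A Lie bracket as a bilinear map. -/
def toLinearMap (hbr : IsLieBracket br) : V →ₗ[ℝ] V →ₗ[ℝ] V :=
  LinearMap.mk₂ ℝ br hbr.add_left hbr.smul_left hbr.add_right fun t X Y => hbr.smul_right t X Y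

@[simp]
theorem toLinearMap_apply (hbr : IsLieBracket br) (X Y : V) : hbr.toLinearMap X Y = br X Y := rfl

end IsLieBracket

/-- A subspace stable under bracketing with arbitrary vectors. -/
def IsBracketIdeal (br : V → V → V) (U : Submodule ℝ V) : Prop :=
  ∀ y, ∀ u ∈ U, br y u ∈ U

theorem IsBracketIdeal.sup_span {br : V → V → V} (hbr : IsLieBracket br) {U : Submodule ℝ V}
    (hU : IsBracketIdeal br U) {x : V} (hx : ∀ y, br y x ∈ U) :
    IsBracketIdeal br (U ⊔ ℝ ∙ x) := by
  intro y v hv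
  obtain ⟨u, hu, w, hw, rfl⟩ := Submodule.mem_sup.mp hv
  obtain ⟨t, rfl⟩ := Submodule.mem_span_singleton.mp hw
  rw [hbr.add_right, hbr.smul_right]
  exact Submodule.mem_sup_left (U.add_mem (hU y u hu) (U.smul_mem t (hx y)))

theorem notMem_of_mem_orthogonal {U : Submodule ℝ V} {x : V} (hx : x ∈ Uᗮ) (hx₁ : ‖x‖ = 1) :
    x ∉ U := by
  intro h
  have : ⟪x, x⟫_ℝ = 0 := hx x h
  simp [hx₁] at this

section FiniteDimensional

variable [FiniteDimensional ℝ V]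

theorem finrank_le_sup_span {U : Submodule ℝ V} {k : ℕ} (hk : finrank ℝ V ≤ finrank ℝ U + (k + 1))
    {x : V} (hx : x ∉ U) : finrank ℝ V ≤ finrank ℝ (U ⊔ ℝ ∙ x : Submodule ℝ V) + k := by
  have hlt : U < U ⊔ ℝ ∙ x := by
    refine lt_of_le_of_ne le_sup_left fun h => hx ?_
    rw [h]
    exact Submodule.mem_sup_right (Submodule.mem_span_singleton_self x)
  have := Submodule.finrank_lt_finrank_of_lt hlt
  omega

/-- A proper ideal `U` of a nilpotent Lie algebra admits a unit normal vector which is central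
modulo `U`. -/
theorem exists_unit_central_mod {br : V → V → V} (hbr : IsLieBracket br)
    (hnilp : IsNilpotentBracket br) {U : Submodule ℝ V} (hU : IsBracketIdeal br U) (hne : U ≠ ⊤) :
    ∃ x ∈ Uᗮ, ‖x‖ = 1 ∧ ∀ y, br y x ∈ U := by
  classical
  have hex : ∃ k : ℕ, ∀ (f : Fin k → V) (X : V), (List.ofFn f).foldr br X ∈ U := by
    obtain ⟨k, hk⟩ := hnilp
    exact ⟨k, fun f X => by rw [hk]; exact U.zero_mem⟩
  obtain ⟨w, hw, hwU⟩ : ∃ w ∉ U, ∀ y, br y w ∈ U := by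
    have hspec := Nat.find_spec hex
    have hmin := fun m => Nat.find_min (m := m) hex
    rcases hk : Nat.find hex with _ | k
    · rw [hk] at hspec
      exact absurd (eq_top_iff.mpr fun v _ => by simpa using hspec Fin.elim0 v) hne
    · rw [hk] at hspec hmin
      have := hmin k (Nat.lt_succ_self k)
      push Not at this
      obtain ⟨f, X, hf⟩ := this
      refine ⟨_, hf, fun y => ?_⟩
      simpa [List.ofFn_succ] using hspec (Fin.cons y f) X
  set z := w - U.starProjection w with hz
  have hzU : z ∈ Uᗮ := U.sub_starProjection_mem_orthogonal w
  have hz₀ : z ≠ 0 := by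
    intro h
    rw [sub_eq_zero.mp h] at hw
    exact hw (U.starProjection_apply_mem w)
  refine ⟨‖z‖⁻¹ • z, Uᗮ.smul_mem _ hzU, by simp [norm_smul, hz₀], fun y => ?_⟩
  rw [hbr.smul_right, hz, hbr.sub_right]
  exact U.smul_mem _ (U.sub_mem (hwU y) (hU y _ (U.starProjection_apply_mem w)))

theorem exists_central_mod {br : V → V → V} (hbr : IsLieBracket br)
    (hnilp : IsNilpotentBracket br) {U : Submodule ℝ V} (hU : IsBracketIdeal br U) {k : ℕ}
    (hk : finrank ℝ V ≤ finrank ℝ U + (k + 1)) :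
    ∃ x ∈ Uᗮ, (‖x‖ = 1 ∨ x = 0) ∧ (∀ y, br y x ∈ U) ∧
      finrank ℝ V ≤ finrank ℝ (U ⊔ ℝ ∙ x : Submodule ℝ V) + k := by
  by_cases hne : U = ⊤
  · refine ⟨0, Uᗮ.zero_mem, Or.inr rfl, fun y => by simp [hne], ?_⟩
    rw [hne, top_sup_eq, finrank_top]
    exact Nat.le_add_right _ _
  · obtain ⟨x, hxU, hx₁, hx⟩ := exists_unit_central_mod hbr hnilp hU hne
    exact ⟨x, hxU, Or.inl hx₁, hx,
      finrank_le_sup_span hk (notMem_of_mem_orthogonal hxU hx₁)⟩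

/-- The orthogonal complement of `U` contains a unit vector in the kernel of `φ`, unless it is too
small. -/
theorem exists_normal_mem_ker {U : Submodule ℝ V} {k : ℕ}
    (hk : finrank ℝ V ≤ finrank ℝ U + (k + 1)) (φ : V →ₗ[ℝ] ℝ) (hφ : φ = 0 ∨ k ≠ 0) :
    ∃ x ∈ Uᗮ, (‖x‖ = 1 ∨ x = 0) ∧ φ x = 0 ∧
      finrank ℝ V ≤ finrank ℝ (U ⊔ ℝ ∙ x : Submodule ℝ V) + k := by
  by_cases hk' : finrank ℝ V ≤ finrank ℝ U + k
  · exact ⟨0, Uᗮ.zero_mem, Or.inr rfl, map_zero φ, by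
      rwa [Submodule.span_zero_singleton, sup_bot_eq]⟩
  · have hadd := U.finrank_add_finrank_orthogonal
    obtain ⟨x, hxU, hx₀, hx⟩ : ∃ x ∈ Uᗮ, x ≠ 0 ∧ φ x = 0 := by
      have hker : LinearMap.ker (φ ∘ₗ Uᗮ.subtype) ≠ ⊥ := by
        rcases hφ with rfl | hφ
        · intro h
          rw [LinearMap.zero_comp, LinearMap.ker_zero] at h
          have : finrank ℝ Uᗮ = 0 := by rw [← finrank_top, h, finrank_bot]
          omega
        · refine LinearMap.ker_ne_bot_of_finrank_lt ?_
          rw [finrank_self]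
          omega
      obtain ⟨x, hx, hx₀⟩ := Submodule.exists_mem_ne_zero_of_ne_bot hker
      exact ⟨x, x.2, by simpa using hx₀, by simpa using hx⟩
    have hnorm : ‖‖x‖⁻¹ • x‖ = 1 := by simp [norm_smul, hx₀]
    refine ⟨‖x‖⁻¹ • x, Uᗮ.smul_mem _ hxU, Or.inl hnorm, by simp [hx], ?_⟩
    exact finrank_le_sup_span hk (notMem_of_mem_orthogonal (Uᗮ.smul_mem _ hxU) hnorm)

theorem eq_top_of_finrank_le {U : Submodule ℝ V} (h : finrank ℝ V ≤ finrank ℝ U + 0) : U = ⊤ :=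
  Submodule.eq_top_of_finrank_eq (le_antisymm U.finrank_le h)

/-- An ideal of codimension at most two in a nilpotent Lie algebra contains all brackets. -/
theorem bracket_mem_of_codim_le_two {br : V → V → V} (hbr : IsLieBracket br)
    (hnilp : IsNilpotentBracket br) {U : Submodule ℝ V} (hU : IsBracketIdeal br U)
    (hk : finrank ℝ V ≤ finrank ℝ U + 2) (y z : V) : br y z ∈ U := by
  obtain ⟨x, -, -, hx, hk₁⟩ := exists_central_mod hbr hnilp hU hk
  obtain ⟨g, -, -, -, hk₀⟩ := exists_normal_mem_ker hk₁ 0 (Or.inl rfl)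
  have htop := eq_top_of_finrank_le hk₀
  have hx' : ∀ y, br x y ∈ U := fun y => by
    rw [hbr.antisymm]
    exact U.neg_mem (hx y)
  have hU' : ∀ u ∈ U, ∀ y, br u y ∈ U := fun u hu y => by
    rw [hbr.antisymm]
    exact U.neg_mem (hU y u hu)
  have hdec : ∀ v : V, ∃ u ∈ U, ∃ s t : ℝ, v = u + s • x + t • g := fun v => by
    obtain ⟨u', hu', w, hw, rfl⟩ := Submodule.mem_sup.mp (htop ▸ Submodule.mem_top : v ∈ _)
    obtain ⟨u, hu, w', hw', rfl⟩ := Submodule.mem_sup.mp hu'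
    obtain ⟨s, rfl⟩ := Submodule.mem_span_singleton.mp hw'
    obtain ⟨t, rfl⟩ := Submodule.mem_span_singleton.mp hw
    exact ⟨u, hu, s, t, rfl⟩
  obtain ⟨u, hu, s, t, rfl⟩ := hdec y
  obtain ⟨u', hu', s', t', rfl⟩ := hdec z
  simp only [hbr.add_left, hbr.smul_left, hbr.add_right, hbr.smul_right, hbr.self g, smul_zero,
    add_zero]
  repeat' first
    | exact hU' u hu _
    | exact hU _ u' hu'
    | exact hx _
    | exact hx' _
    | apply U.add_mem
    | apply U.smul_mem

/-- A nilpotent metric Lie algebra of dimension at most five has an adapted Parseval frame of five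
orthogonal vectors, each of them a unit vector or zero. -/
theorem exists_adapted_frame {br : V → V → V} (hbr : IsLieBracket br)
    (hnilp : IsNilpotentBracket br) (hdim : finrank ℝ V ≤ 5) [Nontrivial V] :
    ∃ e : Fin 5 → V, (∀ v, ∑ i, ⟪e i, v⟫_ℝ • e i = v) ∧ ‖e 4‖ = 1 ∧
      (∀ y z, ⟪br y z, e 0⟫_ℝ = 0) ∧ (∀ y z, ⟪br y z, e 1⟫_ℝ = 0) ∧
      (∀ y, ⟪br y (e 2), e 2⟫_ℝ = 0) ∧ (∀ y, ⟪br y (e 3), e 2⟫_ℝ = 0) ∧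
      (∀ y, ⟪br y (e 3), e 3⟫_ℝ = 0) ∧ (∀ y, br y (e 4) = 0) ∧
      ⟪br (e 2) (e 3), e 4⟫_ℝ = 0 ∧ ⟪br (e 1) (e 2), e 3⟫_ℝ = 0 ∧
      ⟪br (e 1) (e 3), e 4⟫_ℝ = 0 := by
  have hbot : IsBracketIdeal br ⊥ := fun y u hu => by
    rw [(Submodule.mem_bot ℝ).mp hu, hbr.zero_right]
    exact Submodule.zero_mem _
  obtain ⟨e₄, -, hn₄, hc₄⟩ := exists_unit_central_mod hbr hnilp hbot bot_ne_top
  simp only [Submodule.mem_bot] at hc₄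
  have he₄ : e₄ ≠ 0 := by
    rintro rfl
    simp at hn₄
  have hI₄ : IsBracketIdeal br (ℝ ∙ e₄) := by
    simpa using hbot.sup_span hbr (x := e₄) (by simpa using hc₄)
  have hd₄ : finrank ℝ V ≤ finrank ℝ (ℝ ∙ e₄) + (3 + 1) := by
    rw [finrank_span_singleton he₄]
    omega
  obtain ⟨e₃, hp₃, hn₃, hc₃, hd₃⟩ := exists_central_mod hbr hnilp hI₄ hd₄
  have hI₃ := hI₄.sup_span hbr hc₃
  have hzero₄ : ∀ y, br e₄ y = 0 := fun y => by rw [hbr.antisymm, hc₄, neg_zero]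
  set U₃ : Submodule ℝ V := (ℝ ∙ e₄) ⊔ ℝ ∙ e₃ with hU₃
  have hcomm : ∀ y z, br (br y z) e₃ = 0 := fun y z => by
    have key : ∀ y z, br (br y e₃) z = 0 := fun y z => by
      obtain ⟨t, ht⟩ := Submodule.mem_span_singleton.mp (hc₃ y)
      rw [← ht, hbr.smul_left, hzero₄, smul_zero]
    have hj := hbr.jacobi y z e₃
    rw [key, hbr.antisymm e₃ y, ← neg_one_smul ℝ, hbr.smul_left, key] at hj
    simpa using hj
  obtain ⟨e₂, hp₂, hn₂, hc₂, hv₂, hd₂⟩ : ∃ x ∈ U₃ᗮ, (‖x‖ = 1 ∨ x = 0) ∧ (∀ y, br y x ∈ U₃) ∧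
      ⟪br x e₃, e₄⟫_ℝ = 0 ∧ finrank ℝ V ≤ finrank ℝ (U₃ ⊔ ℝ ∙ x : Submodule ℝ V) + 2 := by
    obtain ⟨x, hp, hn, hc, hd⟩ := exists_central_mod hbr hnilp hI₃ hd₃
    by_cases hv : ⟪br x e₃, e₄⟫_ℝ = 0
    · exact ⟨x, hp, hn, hc, hv, hd⟩
    have hmem : ∀ y z, br y z ∈ U₃ := fun y z => by
      have := bracket_mem_of_codim_le_two hbr hnilp (hI₃.sup_span hbr hc) hd y z
      obtain ⟨u, hu, w, hw, huw⟩ := Submodule.mem_sup.mp this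
      obtain ⟨t, rfl⟩ := Submodule.mem_span_singleton.mp hw
      have hu₃ : br u e₃ = 0 := by
        obtain ⟨p, hp', q, hq, rfl⟩ := Submodule.mem_sup.mp hu
        obtain ⟨r, rfl⟩ := Submodule.mem_span_singleton.mp hp'
        obtain ⟨s, rfl⟩ := Submodule.mem_span_singleton.mp hq
        simp [hbr.add_left, hbr.smul_left, hzero₄, hbr.self]
      have ht : t • br x e₃ = 0 := by
        have := hcomm y z
        rwa [← huw, hbr.add_left, hu₃, zero_add, hbr.smul_left] at this
      have ht₀ : t = 0 := by
        by_contra h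
        exact hv (by rw [(smul_eq_zero.mp ht).resolve_left h, inner_zero_left])
      rw [← huw, ht₀, zero_smul, add_zero]
      exact hu
    obtain ⟨x', hp', hn', hv', hd'⟩ := exists_normal_mem_ker hd₃
      ((innerₗ V e₄) ∘ₗ hbr.toLinearMap.flip e₃) (Or.inr two_ne_zero)
    exact ⟨x', hp', hn', fun y => hmem y x', by simpa [real_inner_comm] using hv', hd'⟩
  have hI₂ := hI₃.sup_span hbr hc₂
  set U₂ : Submodule ℝ V := U₃ ⊔ ℝ ∙ e₂ with hU₂
  have hmem := bracket_mem_of_codim_le_two hbr hnilp hI₂ hd₂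
  obtain ⟨e₁, hp₁, hn₁, hv₁, hw₁, hd₁⟩ : ∃ x ∈ U₂ᗮ, (‖x‖ = 1 ∨ x = 0) ∧
      ⟪br x e₂, e₃⟫_ℝ = 0 ∧ ⟪br x e₃, e₄⟫_ℝ = 0 ∧
      finrank ℝ V ≤ finrank ℝ (U₂ ⊔ ℝ ∙ x : Submodule ℝ V) + 1 := by
    have hbr₃ : ∀ w ∈ U₃, ∀ y, ⟪br w y, e₄⟫_ℝ = -(⟪w, e₃⟫_ℝ * ⟪br y e₃, e₄⟫_ℝ) := by
      intro w hw y
      obtain ⟨p, hp, q, hq, rfl⟩ := Submodule.mem_sup.mp hw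
      have hp₀ : ⟪p, e₃⟫_ℝ = 0 := hp₃ p hp
      obtain ⟨r, rfl⟩ := Submodule.mem_span_singleton.mp hp
      obtain ⟨s, rfl⟩ := Submodule.mem_span_singleton.mp hq
      rw [hbr.add_left, hbr.smul_left, hbr.smul_left, hzero₄, inner_add_left, inner_add_left, hp₀,
        hbr.antisymm e₃ y]
      rcases hn₃ with h | h
      · simp [real_inner_smul_left, h]
      · simp [h, hbr.zero_right]
    have hprop : ∀ y z, ⟪br z e₂, e₃⟫_ℝ * ⟪br y e₃, e₄⟫_ℝ =
        ⟪br y e₂, e₃⟫_ℝ * ⟪br z e₃, e₄⟫_ℝ := fun y z => by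
      obtain ⟨u, hu, w, hw, huw⟩ := Submodule.mem_sup.mp (hmem y z)
      obtain ⟨t, rfl⟩ := Submodule.mem_span_singleton.mp hw
      have hfirst : ⟪br (br y z) e₂, e₄⟫_ℝ = 0 := by
        rw [← huw, hbr.add_left, hbr.smul_left, hbr.self, smul_zero, add_zero, hbr₃ u hu, hv₂,
          mul_zero, neg_zero]
      have hj := congrArg (fun v => ⟪v, e₄⟫_ℝ) (hbr.jacobi y z e₂)
      simp only [inner_add_left, inner_zero_left] at hj
      rw [hfirst, hbr₃ _ (hc₂ z), hbr.antisymm e₂ y,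
        hbr₃ _ (U₃.neg_mem (hc₂ y)), inner_neg_left] at hj
      linarith
    by_cases hg : ∀ g, ⟪br g e₂, e₃⟫_ℝ = 0
    · obtain ⟨x, hp, hn, hv, hd⟩ := exists_normal_mem_ker hd₂
        ((innerₗ V e₄) ∘ₗ hbr.toLinearMap.flip e₃) (Or.inr one_ne_zero)
      exact ⟨x, hp, hn, hg x, by simpa [real_inner_comm] using hv, hd⟩
    · push Not at hg
      obtain ⟨g, hg⟩ := hg
      obtain ⟨x, hp, hn, hv, hd⟩ := exists_normal_mem_ker hd₂
        ((innerₗ V e₃) ∘ₗ hbr.toLinearMap.flip e₂) (Or.inr one_ne_zero)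
      have hv' : ⟪br x e₂, e₃⟫_ℝ = 0 := by simpa [real_inner_comm] using hv
      refine ⟨x, hp, hn, hv', ?_, hd⟩
      have := hprop x g
      rw [hv', zero_mul] at this
      exact (mul_eq_zero.mp this).resolve_left hg
  obtain ⟨e₀, hp₀, hn₀, -, hd₀⟩ := exists_normal_mem_ker hd₁ 0 (Or.inl rfl)
  have htop := eq_top_of_finrank_le hd₀
  have hm₄ : e₄ ∈ U₃ := Submodule.mem_sup_left (Submodule.mem_span_singleton_self e₄)
  have hm₃ : e₃ ∈ U₃ := Submodule.mem_sup_right (Submodule.mem_span_singleton_self e₃)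
  have hle₃ : U₃ ≤ U₂ := le_sup_left
  have hm₂ : e₂ ∈ U₂ := Submodule.mem_sup_right (Submodule.mem_span_singleton_self e₂)
  have hle₂ : U₂ ≤ U₂ ⊔ ℝ ∙ e₁ := le_sup_left
  have hm₁ : e₁ ∈ U₂ ⊔ ℝ ∙ e₁ :=
    Submodule.mem_sup_right (Submodule.mem_span_singleton_self e₁)
  have hnormal {x : V} (hx : ‖x‖ = 1 ∨ x = 0) : ⟪x, x⟫_ℝ • x = x := by
    rcases hx with h | h <;> simp [h]
  have h₄₃ : ⟪e₄, e₃⟫_ℝ = 0 := hp₃ _ (Submodule.mem_span_singleton_self e₄)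
  have h₄₂ : ⟪e₄, e₂⟫_ℝ = 0 := hp₂ _ hm₄
  have h₃₂ : ⟪e₃, e₂⟫_ℝ = 0 := hp₂ _ hm₃
  have h₄₁ : ⟪e₄, e₁⟫_ℝ = 0 := hp₁ _ (hle₃ hm₄)
  have h₃₁ : ⟪e₃, e₁⟫_ℝ = 0 := hp₁ _ (hle₃ hm₃)
  have h₂₁ : ⟪e₂, e₁⟫_ℝ = 0 := hp₁ _ hm₂
  have h₄₀ : ⟪e₄, e₀⟫_ℝ = 0 := hp₀ _ (hle₂ (hle₃ hm₄))
  have h₃₀ : ⟪e₃, e₀⟫_ℝ = 0 := hp₀ _ (hle₂ (hle₃ hm₃))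
  have h₂₀ : ⟪e₂, e₀⟫_ℝ = 0 := hp₀ _ (hle₂ hm₂)
  have h₁₀ : ⟪e₁, e₀⟫_ℝ = 0 := hp₀ _ hm₁
  refine ⟨![e₀, e₁, e₂, e₃, e₄], fun v => ?_, hn₄, fun y z => hp₀ _ (hle₂ (hmem y z)),
    fun y z => hp₁ _ (hmem y z), fun y => hp₂ _ (hc₂ y), fun y => ?_, fun y => hp₃ _ (hc₃ y),
    hc₄, hv₂, hv₁, hw₁⟩
  · obtain ⟨v₁, hv₁, w, hw, rfl⟩ := Submodule.mem_sup.mp (htop ▸ Submodule.mem_top : v ∈ _)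
    obtain ⟨t₀, rfl⟩ := Submodule.mem_span_singleton.mp hw
    obtain ⟨v₂, hv₂, w, hw, rfl⟩ := Submodule.mem_sup.mp hv₁
    obtain ⟨t₁, rfl⟩ := Submodule.mem_span_singleton.mp hw
    obtain ⟨v₃, hv₃, w, hw, rfl⟩ := Submodule.mem_sup.mp hv₂
    obtain ⟨t₂, rfl⟩ := Submodule.mem_span_singleton.mp hw
    obtain ⟨v₄, hv₄, w, hw, rfl⟩ := Submodule.mem_sup.mp hv₃
    obtain ⟨t₃, rfl⟩ := Submodule.mem_span_singleton.mp hw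
    obtain ⟨t₄, rfl⟩ := Submodule.mem_span_singleton.mp hv₄
    simp only [Fin.sum_univ_five, Matrix.cons_val, inner_add_right, real_inner_smul_right,
      h₄₃, h₄₂, h₃₂, h₄₁, h₃₁, h₂₁, h₄₀, h₃₀, h₂₀, h₁₀, real_inner_comm e₄, real_inner_comm e₃ e₂,
      real_inner_comm e₃ e₁, real_inner_comm e₃ e₀, real_inner_comm e₂ e₁, real_inner_comm e₂ e₀,
      real_inner_comm e₁ e₀, mul_zero, zero_add, add_zero, mul_smul, hnormal hn₀, hnormal hn₁,
      hnormal hn₂, hnormal hn₃, hnormal (Or.inl hn₄)]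
    abel
  · obtain ⟨t, ht⟩ := Submodule.mem_span_singleton.mp (hc₃ y)
    change ⟪br y e₃, e₂⟫_ℝ = 0
    rw [← ht, real_inner_smul_left, h₄₂, mul_zero]

end FiniteDimensional

/-! ### Parseval frames -/

theorem apply_eq_sum_of_parseval {κ : Type*} [Fintype κ] {f : κ → V}
    (hf : ∀ v, ∑ i, ⟪f i, v⟫_ℝ • f i = v) {φ : V → ℝ} (hφ : IsLinearMap ℝ φ) (v : V) :
    φ v = ∑ i, ⟪f i, v⟫_ℝ * φ (f i) := by
  have := congrArg (hφ.mk' φ) (hf v)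
  simpa [map_sum] using this.symm

/-- Contraction of two linear forms may be computed in any orthonormal basis or Parseval frame. -/
theorem sum_mul_eq_of_parseval {ι κ : Type*} [Fintype ι] [Fintype κ] (e : OrthonormalBasis ι ℝ V)
    {f : κ → V} (hf : ∀ v, ∑ i, ⟪f i, v⟫_ℝ • f i = v) {φ ψ : V → ℝ} (hφ : IsLinearMap ℝ φ)
    (hψ : IsLinearMap ℝ ψ) : ∑ a, φ (e a) * ψ (e a) = ∑ i, φ (f i) * ψ (f i) := by
  calc ∑ a, φ (e a) * ψ (e a)
      = ∑ a, ∑ i, φ (f i) * (⟪e a, f i⟫_ℝ * ψ (e a)) := by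
        refine Finset.sum_congr rfl fun a _ => ?_
        rw [apply_eq_sum_of_parseval hf hφ (e a), Finset.sum_mul]
        exact Finset.sum_congr rfl fun i _ => by rw [real_inner_comm]; ring
    _ = ∑ i, φ (f i) * ψ (f i) := by
        rw [Finset.sum_comm]
        refine Finset.sum_congr rfl fun i _ => ?_
        rw [← Finset.mul_sum, ← apply_eq_sum_of_parseval e.sum_repr' hψ (f i)]

section LeviCivita

variable {br nab : V → V → V}

theorem IsLeviCivita.isLinearMap_left (hbr : IsLieBracket br) (hnab : IsLeviCivita br nab)
    (W : V) : IsLinearMap ℝ fun U => nab U W where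
  map_add U U' := by
    refine ext_inner_right ℝ fun Z => ?_
    rw [inner_add_left, hnab, hnab, hnab, hbr.add_left, hbr.add_right]
    simp only [inner_add_left, inner_add_right]
    ring
  map_smul t U := by
    refine ext_inner_right ℝ fun Z => ?_
    rw [real_inner_smul_left, hnab, hnab, hbr.smul_left, hbr.smul_right]
    simp only [real_inner_smul_left, real_inner_smul_right]
    ring

theorem IsLeviCivita.isLinearMap_right (hbr : IsLieBracket br) (hnab : IsLeviCivita br nab)
    (U : V) : IsLinearMap ℝ (nab U) where
  map_add W W' := by
    refine ext_inner_right ℝ fun Z => ?_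
    rw [inner_add_left, hnab, hnab, hnab, hbr.add_left, hbr.add_right]
    simp only [inner_add_left, inner_add_right]
    ring
  map_smul t W := by
    refine ext_inner_right ℝ fun Z => ?_
    rw [real_inner_smul_left, hnab, hnab, hbr.smul_left, hbr.smul_right]
    simp only [real_inner_smul_left, real_inner_smul_right]
    ring

theorem isLinearMap_curv₁ (hbr : IsLieBracket br) (hnab : IsLeviCivita br nab) (Y Z W : V) :
    IsLinearMap ℝ fun X => curv br nab X Y Z W where
  map_add X X' := by
    simp only [curv, curvOp, hbr.add_left, (hnab.isLinearMap_left hbr _).map_add,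
      (hnab.isLinearMap_right hbr _).map_add, inner_add_left, inner_sub_left]
    ring
  map_smul t X := by
    simp only [curv, curvOp, hbr.smul_left, (hnab.isLinearMap_left hbr _).map_smul,
      (hnab.isLinearMap_right hbr _).map_smul, real_inner_smul_left, inner_sub_left, smul_eq_mul]
    ring

theorem isLinearMap_curv₂ (hbr : IsLieBracket br) (hnab : IsLeviCivita br nab) (X Z W : V) :
    IsLinearMap ℝ fun Y => curv br nab X Y Z W where
  map_add Y Y' := by
    simp only [curv, curvOp, hbr.add_right, (hnab.isLinearMap_left hbr _).map_add,
      (hnab.isLinearMap_right hbr _).map_add, inner_add_left, inner_sub_left]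
    ring
  map_smul t Y := by
    simp only [curv, curvOp, hbr.smul_right, (hnab.isLinearMap_left hbr _).map_smul,
      (hnab.isLinearMap_right hbr _).map_smul, real_inner_smul_left, inner_sub_left, smul_eq_mul]
    ring

theorem isLinearMap_curv₃ (hbr : IsLieBracket br) (hnab : IsLeviCivita br nab) (X Y W : V) :
    IsLinearMap ℝ fun Z => curv br nab X Y Z W where
  map_add Z Z' := by
    simp only [curv, curvOp, (hnab.isLinearMap_right hbr _).map_add, inner_add_left,
      inner_sub_left]
    ring
  map_smul t Z := by
    simp only [curv, curvOp, (hnab.isLinearMap_right hbr _).map_smul, real_inner_smul_left,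
      inner_sub_left, smul_eq_mul]
    ring

theorem isLinearMap_curv₄ (br nab : V → V → V) (X Y Z : V) : IsLinearMap ℝ fun W => curv br nab X Y Z W where
  map_add W W' := by simp only [curv, inner_add_right]
  map_smul t W := by simp only [curv, real_inner_smul_right, smul_eq_mul]

/-- `Ř` may be computed in any Parseval frame. -/
theorem checkR_eq_of_parseval (hbr : IsLieBracket br) (hnab : IsLeviCivita br nab)
    {ι κ : Type*} [Fintype ι] [Fintype κ] (e : OrthonormalBasis ι ℝ V)
    {f : κ → V} (hf : ∀ v, ∑ i, ⟪f i, v⟫_ℝ • f i = v) (X Y : V) :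
    checkR br nab e X Y =
      ∑ i, ∑ j, ∑ k, curv br nab X (f i) (f j) (f k) * curv br nab Y (f i) (f j) (f k) := by
  have h₄ (u v : V) := sum_mul_eq_of_parseval e hf
    (isLinearMap_curv₄ br nab X u v) (isLinearMap_curv₄ br nab Y u v)
  have h₃ (u w : V) := sum_mul_eq_of_parseval e hf
    (isLinearMap_curv₃ hbr hnab X u w) (isLinearMap_curv₃ hbr hnab Y u w)
  have h₂ (v w : V) := sum_mul_eq_of_parseval e hf
    (isLinearMap_curv₂ hbr hnab X v w) (isLinearMap_curv₂ hbr hnab Y v w)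
  have hinner (u : V) :
      ∑ b, ∑ c, curv br nab X u (e b) (e c) * curv br nab Y u (e b) (e c) =
        ∑ j, ∑ k, curv br nab X u (f j) (f k) * curv br nab Y u (f j) (f k) := by
    simp only [h₄]
    rw [Finset.sum_comm]
    simp only [h₃]
    exact Finset.sum_comm
  simp only [checkR, hinner]
  rw [Finset.sum_comm]
  refine Eq.trans (Finset.sum_congr rfl fun j _ => ?_) Finset.sum_comm
  rw [Finset.sum_comm]
  simp only [h₂]
  exact Finset.sum_comm

theorem sum_checkR_eq_of_parseval (hbr : IsLieBracket br) (hnab : IsLeviCivita br nab)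
    {ι κ : Type*} [Fintype ι] [Fintype κ] (e : OrthonormalBasis ι ℝ V)
    {f : κ → V} (hf : ∀ v, ∑ i, ⟪f i, v⟫_ℝ • f i = v) :
    ∑ a, checkR br nab e (e a) (e a) = ∑ i, checkR br nab e (f i) (f i) := by
  have h₁ (u v w : V) := sum_mul_eq_of_parseval e hf
    (isLinearMap_curv₁ hbr hnab u v w) (isLinearMap_curv₁ hbr hnab u v w)
  simp only [checkR]
  rw [Finset.sum_comm]
  refine Eq.trans (Finset.sum_congr rfl fun a _ => ?_) Finset.sum_comm
  rw [Finset.sum_comm]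
  refine Eq.trans (Finset.sum_congr rfl fun b _ => ?_) Finset.sum_comm
  rw [Finset.sum_comm]
  simp only [h₁]
  exact Finset.sum_comm

/-- The curvature components in a Parseval frame of five vectors. -/
theorem curv_eq_curvCoeff (hbr : IsLieBracket br) (hnab : IsLeviCivita br nab)
    {f : Fin 5 → V} (hf : ∀ v, ∑ i, ⟪f i, v⟫_ℝ • f i = v) (x y z w : Fin 5) :
    curv br nab (f x) (f y) (f z) (f w) =
      curvCoeff (fun i j k => ⟪br (f i) (f j), f k⟫_ℝ) x y z w := by
  have hΓ (i j k : Fin 5) : christoffel (fun i j k => ⟪br (f i) (f j), f k⟫_ℝ) i j k =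
      ⟪nab (f i) (f j), f k⟫_ℝ := (hnab _ _ _).symm
  have hright (u v : V) : ⟪nab u v, f w⟫_ℝ = ∑ m, ⟪v, f m⟫_ℝ * ⟪nab u (f m), f w⟫_ℝ := by
    have hlin : IsLinearMap ℝ fun v => ⟪nab u v, f w⟫_ℝ :=
      ⟨fun a b => by rw [(hnab.isLinearMap_right hbr u).map_add, inner_add_left],
        fun t a => by rw [(hnab.isLinearMap_right hbr u).map_smul, real_inner_smul_left]; rfl⟩
    simpa only [real_inner_comm v] using apply_eq_sum_of_parseval hf hlin v
  have hleft (u v : V) : ⟪nab u v, f w⟫_ℝ = ∑ m, ⟪u, f m⟫_ℝ * ⟪nab (f m) v, f w⟫_ℝ := by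
    have hlin : IsLinearMap ℝ fun u => ⟪nab u v, f w⟫_ℝ :=
      ⟨fun a b => by rw [(hnab.isLinearMap_left hbr v).map_add, inner_add_left],
        fun t a => by rw [(hnab.isLinearMap_left hbr v).map_smul, real_inner_smul_left]; rfl⟩
    simpa only [real_inner_comm u] using apply_eq_sum_of_parseval hf hlin u
  rw [curv, curvOp, inner_sub_left, inner_sub_left, hright (f x), hright (f y),
    hleft (br (f x) (f y)), curvCoeff, Finset.sum_sub_distrib, Finset.sum_sub_distrib]
  simp only [hΓ]

end LeviCivita

theorem eq_zero_of_structureConst_eq_zero {br : V → V → V} (hbr : IsLieBracket br)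
    {κ : Type*} [Fintype κ] {f : κ → V} (hf : ∀ v, ∑ i, ⟪f i, v⟫_ℝ • f i = v)
    (h : ∀ i j k, ⟪br (f i) (f j), f k⟫_ℝ = 0) (X Y : V) : br X Y = 0 := by
  have h₁ (i j : κ) : br (f i) (f j) = 0 := by
    rw [← hf (br (f i) (f j))]
    exact Finset.sum_eq_zero fun k _ => by rw [real_inner_comm, h, zero_smul]
  change hbr.toLinearMap X Y = 0
  rw [← hf X, ← hf Y]
  simp [h₁]

/-- **Theorem 3 of the paper.** A nilpotent, non-abelian metric
Lie algebra of dimension at most 5 is not weakly Einstein. -/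
theorem nilpotent_dim_le_five_not_weaklyEinstein
    {V : Type*} [NormedAddCommGroup V] [InnerProductSpace ℝ V] [FiniteDimensional ℝ V]
    (hdim : finrank ℝ V ≤ 5)
    (br : V → V → V) (hbr : IsLieBracket br)
    (hnilp : IsNilpotentBracket br)
    (hnonab : ∃ X Y : V, br X Y ≠ 0)
    (nab : V → V → V) (hnab : IsLeviCivita br nab)
    {ι : Type*} [Fintype ι] (e : OrthonormalBasis ι ℝ V) :
    ¬ WeaklyEinstein br nab e := by
  intro hWE
  obtain ⟨X₀, Y₀, hXY⟩ := hnonab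
  have : Nontrivial V := ⟨br X₀ Y₀, 0, hXY⟩
  obtain ⟨f, hf, hn, h0, h1, h22, h32, h33, h4, h234, h123, h134⟩ :=
    exists_adapted_frame hbr hnilp hdim
  set k : Fin 5 → Fin 5 → Fin 5 → ℝ := fun i j l => ⟪br (f i) (f j), f l⟫_ℝ with hk
  have hanti : ∀ i j l, k i j l = -k j i l := fun i j l => by
    simp only [hk]
    rw [hbr.antisymm, inner_neg_left]
  have hkA := eq_adaptedConst hanti (fun i j => h0 _ _) (fun i j => h1 _ _) (fun i => h22 _)
    (fun i => h32 _) (fun i => h33 _) (fun i l => by simp only [hk, h4, inner_zero_left])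
    h234 h123 h134
  have hcheck (i : Fin 5) : checkR br nab e (f i) (f i) = ∑ y, curvNormSq k i y := by
    rw [checkR_eq_of_parseval hbr hnab e hf]
    simp only [curv_eq_curvCoeff hbr hnab hf, curvNormSq, sq, hk]
  have hS : ∑ a, checkR br nab e (e a) (e a) = ∑ x, ∑ y, curvNormSq k x y := by
    rw [sum_checkR_eq_of_parseval hbr hnab e hf]
    exact Finset.sum_congr rfl fun i _ => hcheck i
  have hcard : finrank ℝ V = Fintype.card ι := finrank_eq_card_basis e.toBasis
  have hcard₀ : (0 : ℝ) < Fintype.card ι := by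
    rw [← hcard]
    exact_mod_cast finrank_pos
  have hcard₅ : (Fintype.card ι : ℝ) ≤ 5 := by
    rw [← hcard]
    exact_mod_cast hdim
  have hZ := hWE (f 4) (f 4)
  rw [hcheck, hS, real_inner_self_eq_norm_sq, hn, one_pow, mul_one, eq_div_iff hcard₀.ne'] at hZ
  have hZ₀ : 0 ≤ ∑ y, curvNormSq k 4 y :=
    Finset.sum_nonneg fun y _ => Finset.sum_nonneg fun z _ =>
      Finset.sum_nonneg fun w _ => sq_nonneg _
  have hle : ∑ x, ∑ y, curvNormSq k x y - 5 * ∑ y, curvNormSq k 4 y ≤ 0 := by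
    nlinarith
  rw [hkA] at hanti hle
  rw [sum_curvNormSq_adaptedConst _ _ _ _ _ _ _ hanti] at hle
  have hpos := quartic_pos (k 0 1 2) (k 0 1 3) (k 0 1 4) (k 0 2 3) (k 0 2 4) (k 0 3 4) (k 1 2 4)
  have hzero : ∀ t ∈ [k 0 1 2, k 0 1 3, k 0 1 4, k 0 2 3, k 0 2 4, k 0 3 4, k 1 2 4], t = 0 := by
    intro t ht
    have ht₄ : t ^ 4 ≤ 0 := by
      have hnn (s : ℝ) : 0 ≤ s ^ 4 := by positivity
      simp only [List.mem_cons, List.not_mem_nil, or_false] at ht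
      rcases ht with h | h | h | h | h | h | h <;> rw [h] <;>
        linarith [hnn (k 0 1 2), hnn (k 0 1 3), hnn (k 0 1 4), hnn (k 0 2 3), hnn (k 0 2 4),
          hnn (k 0 3 4), hnn (k 1 2 4)]
    exact pow_eq_zero_iff four_ne_zero |>.mp (le_antisymm ht₄ (by positivity))
  simp only [List.mem_cons, List.not_mem_nil, or_false, forall_eq_or_imp, forall_eq] at hzero
  obtain ⟨ha, hb, hc, hd, hf', hg, hh⟩ := hzero
  rw [ha, hb, hc, hd, hf', hg, hh] at hkA
  refine hXY (eq_zero_of_structureConst_eq_zero hbr hf (fun i j l => ?_) X₀ Y₀)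
  change k i j l = 0
  rw [hkA, adaptedConst_zero]
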